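/- arXiv:1205.6048 — 3 statements merged into one kernel-verified Lean document; each statement's English description precedes it below -/
import Mathlib

section
/- Let V be a real vector space carrying an (s,t)-Clifford family with s + t ≥ 2, that is, linear endomorphisms J_1, …, J_s, I_1, …, I_t of V with J_a ∘ J_a = id, I_b ∘ I_b = −id, and K ∘ K' = −K' ∘ K for any two distinct members K, K' of the family. Suppose t : V × V → V is a symmetric ℝ-bilinear map such that for every fixed Y ∈ V the linear map X ↦ t(X, Y) commutes with every member K of the family, i.e. t(K X, Y) = K(t(X, Y)) for all X, Y ∈ V and all generators K. Then t = 0. (In other words, the first prolongation of the Lie algebra gl(m, 𝒪) of the structure group GL(m, 𝒪) of an almost Clifford manifold based on 𝒪 = Cl(s,t), s + t > 1, vanishes.) -/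
/-- **Vanishing of the first prolongation for an almost Clifford structure.**
Let `V` be a real vector space carrying an `(s,t)`-Clifford family with
`s + t ≥ 2`: linear endomorphisms `g 0, …, g (s+t-1)` where the first `s`
(the `J`'s) square to `id`, the remaining `t` (the `I`'s) square to `-id`,
and any two distinct members anticommute.  If `B : V × V → V` is a symmetric
`ℝ`-bilinear map such that for every fixed `Y` the linear map `X ↦ B X Y`
commutes with every member of the family, then `B = 0`. -/
theorem first_prolongation_almost_clifford_vanishes
    {V : Type*} [AddCommGroup V] [Module ℝ V] (s t : ℕ) (hst : 2 ≤ s + t)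
    (g : Fin (s + t) → Module.End ℝ V)
    (hsq : ∀ i : Fin (s + t), g i * g i = if (i : ℕ) < s then 1 else -1)
    (hanti : ∀ i j : Fin (s + t), i ≠ j → g i * g j = -(g j * g i))
    (B : V →ₗ[ℝ] V →ₗ[ℝ] V)
    (hsymm : ∀ X Y : V, B X Y = B Y X)
    (hcomm : ∀ (i : Fin (s + t)) (X Y : V), B (g i X) Y = g i (B X Y)) :
    B = 0 := by
  have hinj : ∀ (i : Fin (s + t)) (v : V), g i v = 0 → v = 0 := by
    intro i v hv
    have h := LinearMap.congr_fun (hsq i) v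
    rw [Module.End.mul_apply, hv, map_zero] at h
    split_ifs at h
    · simpa using h.symm
    · simpa using h.symm
  let p : Fin (s + t) := ⟨0, by omega⟩
  let q : Fin (s + t) := ⟨1, by omega⟩
  have hpq : p ≠ q := by simp [p, q]
  ext X Y
  have hright : ∀ (i : Fin (s + t)) (X Y : V), B X (g i Y) = g i (B X Y) := by
    intro i X Y
    rw [hsymm, hcomm, hsymm]
  have hcommute : g p (g q (B X Y)) = g q (g p (B X Y)) := by
    rw [← hright q, ← hcomm p, hright q, hcomm p]
  have hanticommute : g p (g q (B X Y)) = -g q (g p (B X Y)) :=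
    LinearMap.congr_fun (hanti p q hpq) (B X Y)
  have hzero : g q (g p (B X Y)) = 0 := by
    have h : (2 : ℝ) • g q (g p (B X Y)) = 0 := by
      rw [two_smul, ← eq_neg_iff_add_eq_zero]
      exact hcommute.symm.trans hanticommute
    exact (smul_eq_zero_iff_right two_ne_zero).mp h
  exact hinj p _ (hinj q _ hzero)
end

section
/- Let V be a real vector space with linear endomorphisms I_1, I_2 satisfying I_1 ∘ I_1 = −id, I_2 ∘ I_2 = −id and I_1 ∘ I_2 = −I_2 ∘ I_1 (so V is a module over the Clifford algebra Cl(0,2) ≅ ℍ). For a linear form ξ : V → ℝ define S^ξ : V × V → V by S^ξ(X,Y) = −ξ(X)Y − ξ(Y)X + ξ(I_1X)I_1Y + ξ(I_1Y)I_1X + ξ(I_2X)I_2Y + ξ(I_2Y)I_2X + ξ(I_1I_2X)I_1I_2Y + ξ(I_1I_2Y)I_1I_2X. Then (i) S^ξ(X,Y) = S^ξ(Y,X) for all X, Y ∈ V, and (ii) for every X ∈ V and each j ∈ {1,2} there exist real numbers a_1, a_2, a_3, a_4 (depending only on X, ξ and j) such that S^ξ(X, I_jY) − I_j(S^ξ(X,Y))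 = a_1 Y + a_2 I_1Y + a_3 I_2Y + a_4 I_1I_2Y for all Y ∈ V. (Hence S^ξ belongs to the first prolongation of the Lie algebra of GL(m, Cl(0,2))·GL(1, Cl(0,2)).) -/
/-- The map `S^ξ` of Remark 1: for a `Cl(0,2)`-structure `(I₁, I₂)` on `V`
and a linear form `ξ`,
`S^ξ(X,Y) = −ξ(X)Y − ξ(Y)X + ξ(I₁X)I₁Y + ξ(I₁Y)I₁X + ξ(I₂X)I₂Y + ξ(I₂Y)I₂X
           + ξ(I₁I₂X)I₁I₂Y + ξ(I₁I₂Y)I₁I₂X`. -/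
noncomputable def Sxi {V : Type*} [AddCommGroup V] [Module ℝ V]
    (I₁ I₂ : Module.End ℝ V) (ξ : V →ₗ[ℝ] ℝ) (X Y : V) : V :=
  -(ξ X • Y) - ξ Y • X
    + ξ (I₁ X) • I₁ Y + ξ (I₁ Y) • I₁ X
    + ξ (I₂ X) • I₂ Y + ξ (I₂ Y) • I₂ X
    + ξ (I₁ (I₂ X)) • I₁ (I₂ Y) + ξ (I₁ (I₂ Y)) • I₁ (I₂ X)

/-- **Remark 1 of the paper.**  Let `V` carry a `Cl(0,2)`-structure:
`I₁² = I₂² = −id` and `I₁I₂ = −I₂I₁`.  Then for any linear form `ξ`: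
(i) `S^ξ` is symmetric, and (ii) for each `X` and each `j ∈ {1,2}` there are
reals `a₁, a₂, a₃, a₄` with
`S^ξ(X, I_jY) − I_j(S^ξ(X,Y)) = a₁Y + a₂I₁Y + a₃I₂Y + a₄I₁I₂Y` for all `Y`;
hence `S^ξ` lies in the first prolongation of the Lie algebra of
`GL(m, Cl(0,2))·GL(1, Cl(0,2))`. -/
theorem Sxi_mem_first_prolongation
    {V : Type*} [AddCommGroup V] [Module ℝ V]
    (I₁ I₂ : Module.End ℝ V)
    (h1 : I₁ * I₁ = -1) (h2 : I₂ * I₂ = -1)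
    (h12 : I₁ * I₂ = -(I₂ * I₁)) (ξ : V →ₗ[ℝ] ℝ) :
    (∀ X Y : V, Sxi I₁ I₂ ξ X Y = Sxi I₁ I₂ ξ Y X) ∧
    (∀ X : V, ∀ J ∈ ({I₁, I₂} : Set (Module.End ℝ V)),
      ∃ a₁ a₂ a₃ a₄ : ℝ, ∀ Y : V,
        Sxi I₁ I₂ ξ X (J Y) - J (Sxi I₁ I₂ ξ X Y)
          = a₁ • Y + a₂ • I₁ Y + a₃ • I₂ Y + a₄ • I₁ (I₂ Y)) := by
  have h11 (v : V) : I₁ (I₁ v) = -v := LinearMap.congr_fun h1 v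
  have h22 (v : V) : I₂ (I₂ v) = -v := LinearMap.congr_fun h2 v
  have h21 (v : V) : I₂ (I₁ v) = -I₁ (I₂ v) := by
    have h : I₁ (I₂ v) = -I₂ (I₁ v) := LinearMap.congr_fun h12 v
    rw [h, neg_neg]
  refine ⟨fun X Y => by simp only [Sxi]; abel, fun X J hJ => ?_⟩
  rcases hJ with rfl | rfl
  · refine ⟨0, 0, 2 * ξ (J (I₂ X)), -2 * ξ (I₂ X), fun Y => ?_⟩
    simp only [Sxi, map_add, map_sub, map_neg, map_smul, h11, h21]
    module
  · refine ⟨0, -2 * ξ (I₁ (J X)), 0, 2 * ξ (I₁ X), fun Y => ?_⟩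
    simp only [Sxi, map_add, map_sub, map_neg, map_smul, h22, h21]
    module
end

section
/- Let V be a real vector space carrying an (s,t)-Clifford family (linear endomorphisms J_1, …, J_s with square id and I_1, …, I_t with square −id, any two distinct members anticommuting), and let F_1, …, F_k, k = 2^{s+t}, be the associated affinors (the identity together with all products of distinct members of the family in a fixed order). Then there exist signs ε_1, …, ε_k ∈ {−1, +1} such that for every ℝ-linear form A : V → ℝ the map S^A : V × V → V defined by S^A(X,Y) = Σ_{i=1}^{k} ε_i · A(F_i X) · F_i Y satisfies the identity S^A(K X, Y) = K(S^A(X,Y)) for every generator K ∈ {J_1, …, J_s, I_1, …, I_t} and all X, Y ∈ V. -/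
/-- The affinor `F_S` associated to a subset `S` of the generators
`g 0, …, g (n-1)` of an `(s,t)`-Clifford family: the ordered product
`g i₁ * ⋯ * g i_r` for `S = {i₁ < ⋯ < i_r}` (the empty product being the
identity).  These `2^n` affinors realize the standard monomial basis of the
Clifford algebra `Cl(s,t)` acting on `V`. -/
noncomputable def cliffordAffinor {V : Type*} [AddCommGroup V] [Module ℝ V]
    {n : ℕ} (g : Fin n → Module.End ℝ V) (S : Finset (Fin n)) : Module.End ℝ V :=
  ((S.sort (· ≤ ·)).map g).prod

section SignedProducts

variable {R ι : Type*} [Ring R] {g : ι → R}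

/-- A product of pairwise anticommuting elements commutes up to sign with each of them. -/
theorem mul_list_prod_eq_or_eq_neg (hanti : ∀ i j, i ≠ j → g i * g j = -(g j * g i))
    (i : ι) (l : List ι) :
    g i * (l.map g).prod = (l.map g).prod * g i ∨
      g i * (l.map g).prod = -((l.map g).prod * g i) := by
  induction l with
  | nil => simp
  | cons a l ih =>
    have h : g i * g a = g a * g i ∨ g i * g a = -(g a * g i) := by
      by_cases hia : i = a
      · subst hia; exact Or.inl rfl
      · exact Or.inr (hanti i a hia)
    simp only [List.map_cons, List.prod_cons]
    rcases h with h | h <;> rcases ih with ih | ih <;>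
      simp [← mul_assoc, h] <;> simp [mul_assoc, ih]

/-- A product of pairwise anticommuting square roots of `±1` squares to `±1`. -/
theorem list_prod_mul_self_eq_or_eq_neg (hsq : ∀ i, g i * g i = 1 ∨ g i * g i = -1)
    (hanti : ∀ i j, i ≠ j → g i * g j = -(g j * g i)) (l : List ι) :
    (l.map g).prod * (l.map g).prod = 1 ∨ (l.map g).prod * (l.map g).prod = -1 := by
  induction l with
  | nil => simp
  | cons a l ih =>
    simp only [List.map_cons, List.prod_cons]
    set P := (l.map g).prod with hP
    have key : g a * P * (g a * P) = g a * (P * g a) * P := by simp only [mul_assoc]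
    have key' : g a * (g a * P) * P = g a * g a * (P * P) := by simp only [mul_assoc]
    rcases mul_list_prod_eq_or_eq_neg hanti a l with h | h
    · rw [← hP] at h
      rw [key, ← h, key']
      rcases hsq a with h1 | h1 <;> rcases ih with h2 | h2 <;> simp [h1, h2]
    · rw [← hP] at h
      rw [key, ← neg_eq_iff_eq_neg.mpr h, mul_neg, neg_mul, key']
      rcases hsq a with h1 | h1 <;> rcases ih with h2 | h2 <;> simp [h1, h2]

/-- Permuting a product of pairwise anticommuting elements changes it at most by a sign. -/
theorem List.Perm.map_prod_eq_or_eq_neg (hanti : ∀ i j, i ≠ j → g i * g j = -(g j * g i))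
    {l l' : List ι} (h : l.Perm l') :
    (l.map g).prod = (l'.map g).prod ∨ (l.map g).prod = -(l'.map g).prod := by
  induction h with
  | nil => simp
  | cons a _ ih => rcases ih with ih | ih <;> simp [ih]
  | swap a b l =>
    by_cases hab : b = a
    · subst hab; exact Or.inl rfl
    · right; simp [← mul_assoc, hanti b a hab]
  | trans _ _ ih₁ ih₂ => rcases ih₁ with h₁ | h₁ <;> rcases ih₂ with h₂ | h₂ <;> simp [h₁, h₂]

end SignedProducts

section Affinors

variable {V : Type*} [AddCommGroup V] [Module ℝ V] {n : ℕ} {g : Fin n → Module.End ℝ V}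

theorem cliffordAffinor_insert_eq_or_eq_neg (hanti : ∀ i j, i ≠ j → g i * g j = -(g j * g i))
    {S : Finset (Fin n)} {j : Fin n} (hj : j ∉ S) :
    cliffordAffinor g (insert j S) = cliffordAffinor g S * g j ∨
      cliffordAffinor g (insert j S) = -(cliffordAffinor g S * g j) := by
  have hperm : ((insert j S).sort (· ≤ ·)).Perm (S.sort (· ≤ ·) ++ [j]) := by
    rw [← Multiset.coe_eq_coe, Finset.sort_eq, Finset.insert_val_of_notMem hj,
      ← Multiset.coe_add, Finset.sort_eq, Multiset.coe_singleton, add_comm,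
      Multiset.singleton_add]
  simpa [cliffordAffinor] using hperm.map_prod_eq_or_eq_neg hanti

/-- Right multiplication by a generator permutes the affinors up to sign. -/
theorem cliffordAffinor_mul_eq_or_eq_neg (hsq : ∀ i, g i * g i = 1 ∨ g i * g i = -1)
    (hanti : ∀ i j, i ≠ j → g i * g j = -(g j * g i)) (S : Finset (Fin n)) (j : Fin n) :
    cliffordAffinor g S * g j = cliffordAffinor g (symmDiff S {j}) ∨
      cliffordAffinor g S * g j = -cliffordAffinor g (symmDiff S {j}) := by
  by_cases hj : j ∈ S
  · have hT : symmDiff S {j} = S.erase j := by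
      ext a; simp only [Finset.mem_symmDiff, Finset.mem_singleton, Finset.mem_erase]; grind
    have h := cliffordAffinor_insert_eq_or_eq_neg hanti (Finset.notMem_erase j S)
    rw [Finset.insert_erase hj] at h
    rw [hT]
    rcases h with h | h <;> rcases hsq j with h1 | h1 <;> simp [h, mul_assoc, h1]
  · have hT : symmDiff S {j} = insert j S := by
      ext a; simp only [Finset.mem_symmDiff, Finset.mem_singleton, Finset.mem_insert]; grind
    rw [hT]
    rcases cliffordAffinor_insert_eq_or_eq_neg hanti hj with h | h <;> simp [h]

end Affinors

/-- **Lemma 3 (choice of signs).**  Let `V` carry an `(s,t)`-Clifford family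
`g` (the first `s` generators square to `id`, the remaining `t` to `-id`,
distinct generators anticommute), with associated affinors
`F_S = cliffordAffinor g S`, `S ⊆ Fin (s+t)` (so `k = 2^(s+t)` affinors).
Then there exist signs `ε_S ∈ {−1, +1}` such that for every linear form
`A : V → ℝ` the map `S^A(X,Y) = Σ_S ε_S A(F_S X) F_S Y` satisfies
`S^A(K X, Y) = K (S^A(X, Y))` for every generator `K = g j`. -/
theorem exists_signs_SA_clifford_linear
    {V : Type*} [AddCommGroup V] [Module ℝ V] (s t : ℕ)
    (g : Fin (s + t) → Module.End ℝ V)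
    (hsq : ∀ i : Fin (s + t), g i * g i = if (i : ℕ) < s then 1 else -1)
    (hanti : ∀ i j : Fin (s + t), i ≠ j → g i * g j = -(g j * g i)) :
    ∃ ε : Finset (Fin (s + t)) → ℝ, (∀ S, ε S = 1 ∨ ε S = -1) ∧
      ∀ (A : V →ₗ[ℝ] ℝ) (j : Fin (s + t)) (X Y : V),
        (∑ S : Finset (Fin (s + t)),
            ε S • (A (cliffordAffinor g S (g j X)) • cliffordAffinor g S Y))
          = g j (∑ S : Finset (Fin (s + t)),
              ε S • (A (cliffordAffinor g S X) • cliffordAffinor g S Y)) := by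
  have hsq' : ∀ i, g i * g i = 1 ∨ g i * g i = -1 := fun i => by
    rw [hsq i]; split_ifs <;> simp
  have hε : ∀ S : Finset (Fin (s + t)), ∃ e : ℝ, (e = 1 ∨ e = -1) ∧
      (e • cliffordAffinor g S) * cliffordAffinor g S = 1 := fun S => by
    rcases list_prod_mul_self_eq_or_eq_neg hsq' hanti (S.sort (· ≤ ·)) with h | h
    · exact ⟨1, Or.inl rfl, by simpa [cliffordAffinor] using h⟩
    · exact ⟨-1, Or.inr rfl, by simp [cliffordAffinor, h]⟩
  choose ε hε hinv using hε
  refine ⟨ε, hε, fun A j X Y => ?_⟩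
  rw [map_sum]
  refine Fintype.sum_equiv (symmDiff_left_involutive {j}).toPerm _ _ fun S => ?_
  change _ = g j (ε (symmDiff S {j}) • (A (cliffordAffinor g (symmDiff S {j}) X) •
    cliffordAffinor g (symmDiff S {j}) Y))
  have hmul := cliffordAffinor_mul_eq_or_eq_neg hsq' hanti S j
  have hS := hinv S
  have hT := hinv (symmDiff S {j})
  generalize symmDiff S {j} = T at *
  have hT' : cliffordAffinor g T * (ε T • cliffordAffinor g T) = 1 := by
    rwa [mul_smul_comm, ← smul_mul_assoc]
  have hg : g j * (ε T • cliffordAffinor g T) = (ε S • cliffordAffinor g S) *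
      (cliffordAffinor g S * g j) * (ε T • cliffordAffinor g T) := by
    rw [← mul_assoc, hS, one_mul]
  have hX : cliffordAffinor g S (g j X) = (cliffordAffinor g S * g j) X := rfl
  have hY : g j (ε T • (A (cliffordAffinor g T X) • cliffordAffinor g T Y)) =
      A (cliffordAffinor g T X) • (g j * (ε T • cliffordAffinor g T)) Y := by
    simp [smul_comm (ε T)]
  rw [hX, hY, hg]
  rcases hmul with h | h <;> rw [h] <;>
    simp only [mul_assoc, neg_mul, mul_neg, hT'] <;> simp [smul_comm (ε S)]
end
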